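/- Let n ≥ 12 be an integer divisible by 6. If F ∈ ℂ[x,y,z] is a nonzero homogeneous polynomial of degree at most n that vanishes to order at least 3 at every point of ℬ_n, then deg(F) = n and there is a scalar c ∈ ℂ such that F = c·ℓ_0·ℓ_1·⋯·ℓ_{n−1}, the product of the defining linear forms of the n configuration lines. In other words, the vector space of homogeneous forms of degree n vanishing to order at least 3 at all points of ℬ_n is one-dimensional, spanned by the product of the configuration lines, and no nonzero form of smaller degree vanishes to order at least 3 at all points of ℬ_n. -/

import Mathlib

open Complex

/-- `P n j = exp(2πij/n)`. -/
noncomputable def Ppt (n j : ℕ) : ℂ := Complex.exp (2 * Real.pi * Complex.I * j / n)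

/-- `Q n j = -exp(-4πij/n)`. -/
noncomputable def Qpt (n j : ℕ) : ℂ := -Complex.exp (-(4 * Real.pi * Complex.I * j) / n)

open scoped Classical in
/-- The `j`-th line of the Böröczky configuration: the line through `P n j` and
`Q n j` if they are distinct, and the tangent line to the unit circle at `P n j`
otherwise (identifying ℝ² with ℂ). -/
noncomputable def Bline (n j : ℕ) : Set ℂ :=
  if Ppt n j = Qpt n j then
    {z : ℂ | (z * (starRingEnd ℂ) (Ppt n j)).re = 1}
  else
    {z : ℂ | ((z - Ppt n j) * (starRingEnd ℂ) (Qpt n j - Ppt n j)).im = 0}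

/-- The set of triple points of the Böröczky configuration: points lying on at
least three of the lines `L_0, …, L_{n-1}`. -/
def TriplePts (n : ℕ) : Set ℂ :=
  {z : ℂ | 3 ≤ ({j : ℕ | j < n ∧ z ∈ Bline n j} : Set ℕ).ncard}

open MvPolynomial

/-- The point of ℂ³ corresponding to a planar point `p` (viewed as the
projective point `[Re p : Im p : 1]`). -/
noncomputable def projPt (p : ℂ) : Fin 3 → ℂ := ![(p.re : ℂ), (p.im : ℂ), 1]

/-- `F` vanishes to order at least `m` at the planar point `p`: every partial
derivative of `F` of total order `< m` vanishes at `(Re p, Im p, 1)`. -/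
def VanishesToOrder (F : MvPolynomial (Fin 3) ℂ) (m : ℕ) (p : ℂ) : Prop :=
  ∀ d : Fin 3 → ℕ, d 0 + d 1 + d 2 < m →
    eval (projPt p)
      ((fun G => pderiv (0 : Fin 3) G)^[d 0]
        ((fun G => pderiv (1 : Fin 3) G)^[d 1]
          ((fun G => pderiv (2 : Fin 3) G)^[d 2] F))) = 0

open scoped Classical in
/-- The defining linear form of the `j`-th configuration line: the determinant
of the matrix with rows `(x,y,z)`, `(Re P_j, Im P_j, 1)`, `(Re Q_j, Im Q_j, 1)`
if `P_j ≠ Q_j`, and `(Re P_j)·x + (Im P_j)·y - z` if `P_j = Q_j`. -/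
noncomputable def ell (n j : ℕ) : MvPolynomial (Fin 3) ℂ :=
  if Ppt n j = Qpt n j then
    C (((Ppt n j).re : ℂ)) * X 0 + C (((Ppt n j).im : ℂ)) * X 1 - X 2
  else
    C ((((Ppt n j).im - (Qpt n j).im : ℝ) : ℂ)) * X 0 -
      C ((((Ppt n j).re - (Qpt n j).re : ℝ) : ℂ)) * X 1 +
      C ((((Ppt n j).re * (Qpt n j).im - (Ppt n j).im * (Qpt n j).re : ℝ) : ℂ)) * X 2

/-! ### Restricting forms to a parametrised line -/

/-- The restriction of `F` to the parametrised line `t ↦ p + t • v`. -/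
noncomputable def restrictLine (p v : Fin 3 → ℂ) (F : MvPolynomial (Fin 3) ℂ) : Polynomial ℂ :=
  aeval (fun i => Polynomial.C (p i) + Polynomial.C (v i) * Polynomial.X) F

lemma eval_restrictLine (p v : Fin 3 → ℂ) (F : MvPolynomial (Fin 3) ℂ) (t : ℂ) :
    (restrictLine p v F).eval t = eval (fun i => p i + v i * t) F := by
  induction F using MvPolynomial.induction_on with
  | C a => simp [restrictLine]
  | add f g hf hg => simp_all [restrictLine]
  | mul_X f i hf => simp_all [restrictLine]

lemma derivative_restrictLine (p v : Fin 3 → ℂ) (F : MvPolynomial (Fin 3) ℂ) :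
    Polynomial.derivative (restrictLine p v F) =
      ∑ i, Polynomial.C (v i) * restrictLine p v (pderiv i F) := by
  induction F using MvPolynomial.induction_on with
  | C a => simp [restrictLine]
  | add f g hf hg =>
    simp only [restrictLine, map_add, mul_add, Finset.sum_add_distrib] at *
    rw [hf, hg]
  | mul_X f i hf =>
    simp only [restrictLine, map_mul, Derivation.leibniz, Polynomial.derivative_mul, map_add,
      smul_eq_mul, mul_add, Finset.sum_add_distrib] at *
    rw [hf]
    simp only [pderiv_X, Pi.single_apply, aeval_X, Finset.sum_mul,
      apply_ite (aeval _), map_one, map_zero, mul_ite, mul_one, mul_zero,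
      Finset.sum_ite_eq, Finset.mem_univ, if_true]
    have hd : Polynomial.derivative (Polynomial.C (p i) + Polynomial.C (v i) * Polynomial.X) =
        Polynomial.C (v i) := by simp
    rw [hd, add_comm, mul_comm _ (Polynomial.C (v i))]
    exact congrArg₂ _ rfl (Finset.sum_congr rfl fun j _ => by ring)

lemma natDegree_restrictLine_le (p v : Fin 3 → ℂ) {F : MvPolynomial (Fin 3) ℂ} {e : ℕ}
    (hF : F.IsHomogeneous e) : (restrictLine p v F).natDegree ≤ e := by
  have h := MvPolynomial.aeval_natDegree_le F hF.totalDegree_le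
    (fun i => Polynomial.C (p i) + Polynomial.C (v i) * Polynomial.X) (n := 1) (fun i => by
      rw [add_comm]; exact Polynomial.natDegree_linear_le)
  simpa [restrictLine] using h

lemma three_le_rootMultiplicity_restrictLine {p v : Fin 3 → ℂ} (hv : v 2 = 0)
    {F : MvPolynomial (Fin 3) ℂ} (h0 : restrictLine p v F ≠ 0) {z : ℂ}
    (hz : (fun i => p i + v i * z) = projPt z) (hF : VanishesToOrder F 3 z) :
    3 ≤ (restrictLine p v F).rootMultiplicity z := by
  have h00 := hF ![0, 0, 0] (by simp)
  have h10 := hF ![1, 0, 0] (by simp)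
  have h01 := hF ![0, 1, 0] (by simp)
  have h20 := hF ![2, 0, 0] (by simp)
  have h11 := hF ![1, 1, 0] (by simp)
  have h02 := hF ![0, 2, 0] (by simp)
  have hcomm : pderiv 1 (pderiv 0 F) = pderiv 0 (pderiv 1 F) := by
    have := congrArg (fun D => D F)
      (show ⁅pderiv (R := ℂ) (1 : Fin 3), pderiv (0 : Fin 3)⁆ = 0 from by
        apply MvPolynomial.derivation_ext
        intro i
        fin_cases i <;> simp [Derivation.commutator_apply, pderiv_X])
    simpa [Derivation.commutator_apply, sub_eq_zero] using this
  simp at h00 h10 h01 h20 h11 h02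
  refine Polynomial.lt_rootMultiplicity_of_isRoot_iterate_derivative h0 fun m hm => ?_
  interval_cases m <;>
    simp [Polynomial.IsRoot, derivative_restrictLine, eval_restrictLine, Fin.sum_univ_three, hv,
      hz, Polynomial.derivative_mul, Polynomial.derivative_C, hcomm, h00, h10, h01, h20, h11, h02]

/-- A polynomial with more zeros, counted with multiplicity, than its degree vanishes. -/
lemma restrictLine_eq_zero {p v : Fin 3 → ℂ} (hv : v 2 = 0)
    {F : MvPolynomial (Fin 3) ℂ} {e : ℕ} (hF : F.IsHomogeneous e) (T U : Finset ℂ)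
    (hTU : Disjoint T U)
    (hz : ∀ z ∈ T ∪ U, (fun i => p i + v i * z) = projPt z)
    (hT : ∀ z ∈ T, VanishesToOrder F 3 z) (hU : ∀ z ∈ U, eval (projPt z) F = 0)
    (hcard : e < 3 * T.card + U.card) : restrictLine p v F = 0 := by
  classical
  by_contra h0
  set f := restrictLine p v F
  have h3 : ∀ z ∈ T, 3 ≤ f.roots.count z := fun z hzT => by
    rw [Polynomial.count_roots]
    exact three_le_rootMultiplicity_restrictLine hv h0 (hz z (by simp [hzT])) (hT z hzT)
  have h1 : ∀ z ∈ U, 1 ≤ f.roots.count z := fun z hzU => by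
    rw [Multiset.one_le_count_iff_mem, Polynomial.mem_roots h0, Polynomial.IsRoot,
      eval_restrictLine, hz z (by simp [hzU]), hU z hzU]
  have hsum : ∑ z ∈ T ∪ U, f.roots.count z ≤ f.roots.card := by
    rw [← Multiset.toFinset_sum_count_eq]
    refine Finset.sum_le_sum_of_ne_zero fun z _ hz0 => ?_
    exact Multiset.mem_toFinset.2 (Multiset.count_ne_zero.1 hz0)
  rw [Finset.sum_union hTU] at hsum
  have hT' := Finset.card_nsmul_le_sum T _ 3 h3
  have hU' := Finset.card_nsmul_le_sum U _ 1 h1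
  have hdeg := (Polynomial.card_roots' f).trans (natDegree_restrictLine_le p v hF)
  simp only [smul_eq_mul] at hT' hU'
  omega

/-! ### The linear forms attached to unit complex numbers -/

/-- A linear form whose zeros are the points `z` with `ω ^ 3 - z * ω ^ 2 + conj z * ω - 1 = 0`. -/
noncomputable def lineForm (ω : ℂ) : MvPolynomial (Fin 3) ℂ :=
  C (ω - ω ^ 2) * X 0 + C (-(I * (ω ^ 2 + ω))) * X 1 + C (ω ^ 3 - 1) * X 2

/-- The point of `ℂ³` with `x + i y = u`, `x - i y = v` and last coordinate `w`. -/
noncomputable def isotropicPt (u v w : ℂ) : Fin 3 → ℂ := ![(u + v) / 2, -I * (u - v) / 2, w]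

lemma eval_lineForm_isotropicPt (ω u v w : ℂ) :
    eval (isotropicPt u v w) (lineForm ω) = -(ω ^ 2 * u) + ω * v + (ω ^ 3 - 1) * w := by
  simp [lineForm, isotropicPt]
  linear_combination (ω ^ 2 + ω) * (u - v) / 2 * I_sq

lemma exists_eq_isotropicPt (x : Fin 3 → ℂ) : ∃ u v, x = isotropicPt u v (x 2) := by
  refine ⟨x 0 + I * x 1, x 0 - I * x 1, ?_⟩
  ext i
  fin_cases i
  · simp [isotropicPt]
  · simp [isotropicPt]
    linear_combination x 1 * I_sq
  · simp [isotropicPt]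

lemma projPt_eq_isotropicPt (z : ℂ) : projPt z = isotropicPt z (starRingEnd ℂ z) 1 := by
  have hI := I_sq
  ext i
  fin_cases i
  · simp [projPt, isotropicPt, Complex.re_eq_add_conj]
  · simp [projPt, isotropicPt, Complex.im_eq_sub_conj]
    field_simp
    linear_combination (z - starRingEnd ℂ z) * hI
  · simp [projPt, isotropicPt]

lemma lineForm_isHomogeneous (ω : ℂ) : (lineForm ω).IsHomogeneous 1 := by
  unfold lineForm
  exact (((isHomogeneous_C_mul_X _ _).add (isHomogeneous_C_mul_X _ _)).add
    (isHomogeneous_C_mul_X _ _))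

lemma lineForm_ne_zero {ω : ℂ} (hω : ω ≠ 0) : lineForm ω ≠ 0 := by
  intro h
  have := eval_lineForm_isotropicPt ω 0 1 0
  simp [h, hω.symm] at this

lemma lineForm_prime {ω : ℂ} (hω : ω ≠ 0) : Prime (lineForm ω) := by
  rw [← irreducible_iff_prime]
  refine irreducible_of_totalDegree_eq_one
    ((lineForm_isHomogeneous ω).totalDegree (lineForm_ne_zero hω)) fun x hx => ?_
  rw [isUnit_iff_ne_zero]
  rintro rfl
  apply lineForm_ne_zero hω
  ext m
  simpa using hx m

lemma not_lineForm_dvd_lineForm {ω η : ℂ} (hη : η ≠ 0) (h : ω ≠ η) :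
    ¬ lineForm ω ∣ lineForm η := by
  rintro ⟨G, hG⟩
  have h1 := congrArg (eval (isotropicPt 1 ω 0)) hG
  rw [map_mul, eval_lineForm_isotropicPt, eval_lineForm_isotropicPt] at h1
  have : η * (ω - η) = 0 := by linear_combination h1
  rcases mul_eq_zero.1 this with h2 | h2
  · exact hη h2
  · exact h (sub_eq_zero.1 h2)

lemma eval_smul_of_isHomogeneous {F : MvPolynomial (Fin 3) ℂ} {e : ℕ} (hF : F.IsHomogeneous e)
    (w : ℂ) (x : Fin 3 → ℂ) : eval (w • x) F = w ^ e * eval x F := by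
  rw [eval_eq, eval_eq, Finset.mul_sum]
  refine Finset.sum_congr rfl fun d hd => ?_
  have hdeg : ∑ i ∈ d.support, d i = e := by
    simpa [Finsupp.weight_apply, Finsupp.sum] using hF (mem_support_iff.1 hd)
  simp only [Pi.smul_apply, smul_eq_mul, mul_pow, Finset.prod_mul_distrib,
    Finset.prod_pow_eq_pow_sum, hdeg]
  ring

/-- Nullstellensatz for a plane, tested only on its affine points. -/
lemma lineForm_dvd_of_forall_eval {ω : ℂ} (hω : ω ≠ 0) {F : MvPolynomial (Fin 3) ℂ} {e : ℕ}
    (hF : F.IsHomogeneous e)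
    (h : ∀ t, eval (isotropicPt t (t * ω - ω ^ 2 + ω⁻¹) 1) F = 0) : lineForm ω ∣ F := by
  have hp := lineForm_prime hω
  have hX : lineForm ω ∣ X 2 * F := by
    have : (Ideal.span {lineForm ω}).IsPrime := (Ideal.span_singleton_prime hp.ne_zero).2 hp
    rw [← Ideal.mem_span_singleton,
      ← MvPolynomial.IsPrime.vanishingIdeal_zeroLocus (K := ℂ) (Ideal.span {lineForm ω}),
      zeroLocus_span, mem_vanishingIdeal_iff]
    intro x hx
    have hx' : eval x (lineForm ω) = 0 := by simpa [aeval_eq_eval] using hx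
    obtain ⟨u, v, huv⟩ := exists_eq_isotropicPt x
    simp only [map_mul, aeval_X, aeval_eq_eval]
    by_cases hw : x 2 = 0
    · simp [hw]
    rw [huv, eval_lineForm_isotropicPt] at hx'
    have hv : v = x 2 * (u / x 2 * ω - ω ^ 2 + ω⁻¹) := by
      field_simp
      linear_combination hx'
    have hxs : x = x 2 • isotropicPt (u / x 2) (u / x 2 * ω - ω ^ 2 + ω⁻¹) 1 := by
      set v' := u / x 2 * ω - ω ^ 2 + ω⁻¹
      have hu : u = x 2 * (u / x 2) := by field_simp
      set u' := u / x 2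
      set w := x 2
      rw [huv, hv, hu]
      ext i
      fin_cases i <;> simp [isotropicPt] <;> ring
    have : eval x F = 0 := by
      rw [hxs, eval_smul_of_isHomogeneous hF]
      simp [h]
    simp [this]
  refine (hp.dvd_or_dvd hX).resolve_left ?_
  rintro ⟨G, hG⟩
  have h1 := congrArg (eval (isotropicPt 0 (-ω ^ 2 + ω⁻¹) 1)) hG
  rw [map_mul, eval_lineForm_isotropicPt] at h1
  have h2 : -(ω ^ 2 * 0) + ω * (-ω ^ 2 + ω⁻¹) + (ω ^ 3 - 1) * 1 = 0 := by field_simp; ring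
  rw [h2] at h1
  simp [isotropicPt] at h1

lemma lineForm_dvd_of_many_zeros {ω : ℂ} (hω : ω ≠ 0) {F : MvPolynomial (Fin 3) ℂ} {e : ℕ}
    (hF : F.IsHomogeneous e) (T U : Finset ℂ) (hTU : Disjoint T U)
    (hz : ∀ z ∈ T ∪ U, eval (projPt z) (lineForm ω) = 0)
    (hT : ∀ z ∈ T, VanishesToOrder F 3 z) (hU : ∀ z ∈ U, eval (projPt z) F = 0)
    (hcard : e < 3 * T.card + U.card) : lineForm ω ∣ F := by
  have key : ∀ t, (fun i => isotropicPt 0 (-ω ^ 2 + ω⁻¹) 1 i + isotropicPt 1 ω 0 i * t) =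
      isotropicPt t (t * ω - ω ^ 2 + ω⁻¹) 1 := by
    intro t
    ext i
    fin_cases i <;> simp [isotropicPt] <;> ring
  have h0 := restrictLine_eq_zero (p := isotropicPt 0 (-ω ^ 2 + ω⁻¹) 1) (v := isotropicPt 1 ω 0)
    (by simp [isotropicPt]) hF T U hTU (fun z hzm => by
      have h1 := hz z hzm
      rw [projPt_eq_isotropicPt, eval_lineForm_isotropicPt] at h1
      rw [key, projPt_eq_isotropicPt]
      congr 1
      field_simp
      linear_combination -h1) hT hU hcard
  refine lineForm_dvd_of_forall_eval hω hF fun t => ?_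
  rw [← key, ← eval_restrictLine, h0, Polynomial.eval_zero]

/-! ### The configuration lines -/

lemma Ppt_eq_pow (n j : ℕ) : Ppt n j = Ppt n 1 ^ j := by
  rw [Ppt, Ppt, ← Complex.exp_nat_mul]
  congr 1
  push_cast
  ring

lemma Ppt_ne_zero (n j : ℕ) : Ppt n j ≠ 0 := Complex.exp_ne_zero _

lemma conj_Ppt (n j : ℕ) : starRingEnd ℂ (Ppt n j) = (Ppt n j)⁻¹ := by
  rw [Ppt, ← Complex.exp_conj, ← Complex.exp_neg]
  congr 1
  simp [map_ofNat]
  ring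

lemma Qpt_eq (n j : ℕ) : Qpt n j = -((Ppt n j)⁻¹ ^ 2) := by
  rw [Qpt, Ppt, ← Complex.exp_neg, ← Complex.exp_nat_mul]
  congr 2
  push_cast
  ring

lemma isPrimitiveRoot_Ppt {n : ℕ} (hn : n ≠ 0) : IsPrimitiveRoot (Ppt n 1) n := by
  simpa [Ppt] using Complex.isPrimitiveRoot_exp n hn

lemma Ppt_injOn {n i j : ℕ} (hi : i < n) (hj : j < n) (h : Ppt n i = Ppt n j) : i = j := by
  rw [Ppt_eq_pow n i, Ppt_eq_pow n j] at h
  exact (isPrimitiveRoot_Ppt (by omega)).pow_inj hi hj h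

lemma Ppt_mul_mul_eq_one {n a b c : ℕ} (hn : n ≠ 0) (h : n ∣ a + b + c) :
    Ppt n a * Ppt n b * Ppt n c = 1 := by
  rw [Ppt_eq_pow n a, Ppt_eq_pow n b, Ppt_eq_pow n c, ← pow_add, ← pow_add]
  exact ((isPrimitiveRoot_Ppt hn).pow_eq_one_iff_dvd _).2 h

lemma mem_Bline_of_eval_eq_zero {n j : ℕ} {z : ℂ}
    (h : eval (projPt z) (lineForm (Ppt n j)) = 0) : z ∈ Bline n j := by
  have hP := Ppt_ne_zero n j
  have hc := conj_Ppt n j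
  have hQ := Qpt_eq n j
  rw [projPt_eq_isotropicPt, eval_lineForm_isotropicPt] at h
  unfold Bline
  split_ifs with hPQ
  · rw [hQ] at hPQ
    have h3 : Ppt n j ^ 3 = -1 := by
      field_simp at hPQ
      linear_combination hPQ
    rw [Set.mem_ofPred_eq, ← Complex.ofReal_inj, Complex.re_eq_add_conj]
    simp only [map_mul, hc, map_inv₀]
    field_simp
    push_cast
    linear_combination Ppt n j * h + (z - Ppt n j) * h3
  · rw [Set.mem_ofPred_eq, ← Complex.ofReal_inj, Complex.im_eq_sub_conj]
    simp only [map_mul, map_sub, hQ, hc, map_inv₀, map_neg, map_pow, inv_inv]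
    field_simp
    push_cast
    linear_combination (Ppt n j ^ 3 + 1) * h

lemma exists_ell_eq (n j : ℕ) : ∃ κ : ℂ, κ ≠ 0 ∧ ell n j = C κ * lineForm (Ppt n j) := by
  have hP := Ppt_ne_zero n j
  have hc := conj_Ppt n j
  have hQ := Qpt_eq n j
  have hI := I_sq
  unfold ell lineForm
  split_ifs with hPQ
  · rw [hQ] at hPQ
    have h3 : Ppt n j ^ 3 = -1 := by
      field_simp at hPQ
      linear_combination hPQ
    refine ⟨1 / 2, by norm_num, ?_⟩
    have e0 : ((Ppt n j).re : ℂ) = 1 / 2 * (Ppt n j - Ppt n j ^ 2) := by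
      rw [Complex.re_eq_add_conj, hc]
      field_simp
      linear_combination h3
    have e1 : ((Ppt n j).im : ℂ) = 1 / 2 * -(I * (Ppt n j ^ 2 + Ppt n j)) := by
      rw [Complex.im_eq_sub_conj, hc]
      field_simp
      linear_combination -h3 + (Ppt n j ^ 2 + Ppt n j ^ 3) * hI
    rw [e0, e1, h3, show (-1 - 1 : ℂ) = -2 by norm_num]
    have : (C (1 / 2) * C (-2) : MvPolynomial (Fin 3) ℂ) = -1 := by
      rw [← C_mul]; norm_num
    simp only [mul_add, ← mul_assoc, ← C_mul] at this ⊢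
    rw [this]
    ring
  · have h3 : Ppt n j ^ 3 + 1 ≠ 0 := fun h => hPQ <| by
      rw [hQ]
      field_simp
      linear_combination h
    refine ⟨(Ppt n j ^ 3 + 1) / (Ppt n j ^ 3 * (2 * I)), by simp [h3, hP], ?_⟩
    have e0 : (((Ppt n j).im - (Qpt n j).im : ℝ) : ℂ) =
        (Ppt n j ^ 3 + 1) / (Ppt n j ^ 3 * (2 * I)) * (Ppt n j - Ppt n j ^ 2) := by
      push_cast
      rw [Complex.im_eq_sub_conj, Complex.im_eq_sub_conj, hQ]
      simp only [map_neg, map_pow, map_inv₀, hc, inv_inv]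
      field_simp
      ring
    have e1 : -(((Ppt n j).re - (Qpt n j).re : ℝ) : ℂ) =
        (Ppt n j ^ 3 + 1) / (Ppt n j ^ 3 * (2 * I)) * -(I * (Ppt n j ^ 2 + Ppt n j)) := by
      push_cast
      rw [Complex.re_eq_add_conj, Complex.re_eq_add_conj, hQ]
      simp only [map_neg, map_pow, map_inv₀, hc, inv_inv]
      field_simp
      ring
    have e2 : (((Ppt n j).re * (Qpt n j).im - (Ppt n j).im * (Qpt n j).re : ℝ) : ℂ) =
        (Ppt n j ^ 3 + 1) / (Ppt n j ^ 3 * (2 * I)) * (Ppt n j ^ 3 - 1) := by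
      push_cast
      rw [Complex.re_eq_add_conj, Complex.re_eq_add_conj, Complex.im_eq_sub_conj,
        Complex.im_eq_sub_conj, hQ]
      simp only [map_neg, map_pow, map_inv₀, hc, inv_inv]
      field_simp
      ring
    rw [e0, e2, sub_eq_add_neg, ← neg_mul, ← C_neg, e1]
    simp only [C_mul]
    ring

lemma associated_ell (n j : ℕ) : Associated (lineForm (Ppt n j)) (ell n j) := by
  obtain ⟨κ, hκ, h⟩ := exists_ell_eq n j
  rw [h]
  exact (associated_unit_mul_left _ _ ((isUnit_iff_ne_zero.2 hκ).map C)).symm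

/-! ### Triple points on a configuration line -/

lemma eval_lineForm_add_add {a b c : ℂ} (ha : starRingEnd ℂ a = a⁻¹) (hb : starRingEnd ℂ b = b⁻¹)
    (hc : starRingEnd ℂ c = c⁻¹) (habc : a * b * c = 1) (ω : ℂ) :
    eval (projPt (a + b + c)) (lineForm ω) = (ω - a) * (ω - b) * (ω - c) := by
  have ha' : a⁻¹ = b * c := inv_eq_of_mul_eq_one_right (by linear_combination habc)
  have hb' : b⁻¹ = a * c := inv_eq_of_mul_eq_one_right (by linear_combination habc)
  have hc' : c⁻¹ = a * b := inv_eq_of_mul_eq_one_right (by linear_combination habc)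
  rw [projPt_eq_isotropicPt, eval_lineForm_isotropicPt, map_add, map_add, ha, hb, hc, ha', hb', hc']
  linear_combination habc

/-- The representative `c < n` of `-(a + b)` modulo `n`, for `a, b < n`. -/
def third (n a b : ℕ) : ℕ :=
  if a + b = 0 then 0 else if a + b ≤ n then n - a - b else 2 * n - a - b

lemma third_lt {n a b : ℕ} (ha : a < n) (hb : b < n) : third n a b < n := by
  unfold third; split_ifs <;> omega

lemma dvd_add_third {n a b : ℕ} (ha : a < n) (hb : b < n) : n ∣ a + b + third n a b := by
  unfold third
  split_ifs with h0 h1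
  · simp [h0]
  · exact ⟨1, by omega⟩
  · exact ⟨2, by omega⟩

/-- The intersection point of the lines `a` and `b`. -/
noncomputable def meetPt (n a b : ℕ) : ℂ := Ppt n a + Ppt n b + Ppt n (third n a b)

lemma eval_meetPt {n a b : ℕ} (ha : a < n) (hb : b < n) (ω : ℂ) :
    eval (projPt (meetPt n a b)) (lineForm ω) =
      (ω - Ppt n a) * (ω - Ppt n b) * (ω - Ppt n (third n a b)) :=
  eval_lineForm_add_add (conj_Ppt n a) (conj_Ppt n b) (conj_Ppt n _)
    (Ppt_mul_mul_eq_one (by omega) (dvd_add_third ha hb)) ω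

lemma eq_or_eq_of_meetPt_eq {n a b b' : ℕ} (ha : a < n) (hb : b < n) (hb' : b' < n)
    (hne : b' ≠ a) (h : meetPt n a b' = meetPt n a b) : b' = b ∨ b' = third n a b := by
  have h1 := eval_meetPt ha hb' (Ppt n b')
  rw [h, eval_meetPt ha hb, sub_self, mul_zero, zero_mul, mul_eq_zero, mul_eq_zero, sub_eq_zero,
    sub_eq_zero, sub_eq_zero] at h1
  rcases h1 with (h1 | h1) | h1
  · exact absurd (Ppt_injOn hb' ha h1) hne
  · exact .inl (Ppt_injOn hb' hb h1)
  · exact .inr (Ppt_injOn hb' (third_lt ha hb) h1)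

/-- The lines which meet the line `a` in a triple point. -/
def partners (n a : ℕ) : Finset ℕ :=
  (Finset.range n).filter fun b => b ≠ a ∧ third n a b ≠ a ∧ third n a b ≠ b

lemma mem_partners {n a b : ℕ} :
    b ∈ partners n a ↔ b < n ∧ b ≠ a ∧ third n a b ≠ a ∧ third n a b ≠ b := by
  simp [partners]

lemma meetPt_mem_TriplePts {n a b : ℕ} (ha : a < n) (hb : b ∈ partners n a) :
    meetPt n a b ∈ TriplePts n := by
  obtain ⟨hbn, hba, hca, hcb⟩ := mem_partners.1 hb
  have hsub : ((({a, b, third n a b} : Finset ℕ)) : Set ℕ) ⊆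
      {j : ℕ | j < n ∧ meetPt n a b ∈ Bline n j} := by
    intro j hj
    simp only [Finset.coe_insert, Finset.coe_singleton, Set.mem_insert_iff,
      Set.mem_singleton_iff] at hj
    rcases hj with rfl | rfl | rfl
    · exact ⟨ha, mem_Bline_of_eval_eq_zero (by rw [eval_meetPt ha hbn]; simp)⟩
    · exact ⟨hbn, mem_Bline_of_eval_eq_zero (by rw [eval_meetPt ha hbn]; simp)⟩
    · exact ⟨third_lt ha hbn, mem_Bline_of_eval_eq_zero (by rw [eval_meetPt ha hbn]; simp)⟩
  have hcard : ({a, b, third n a b} : Finset ℕ).card = 3 :=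
    Finset.card_eq_three.2 ⟨a, b, _, hba.symm, hca.symm, hcb.symm, rfl⟩
  have := Set.ncard_le_ncard hsub ((Set.finite_lt_nat n).subset fun j hj => hj.1)
  rwa [Set.ncard_coe_finset, hcard] at this

/-- The triple points on the line `a`. -/
noncomputable def triplesOn (n a : ℕ) : Finset ℂ := (partners n a).image (meetPt n a)

lemma card_partners_le {n a : ℕ} (ha : a < n) :
    (partners n a).card ≤ 2 * (triplesOn n a).card := by
  refine Finset.card_le_mul_card_image _ 2 fun z hz => ?_
  obtain ⟨b, hb, rfl⟩ := Finset.mem_image.1 hz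
  refine (Finset.card_le_card (t := {b, third n a b}) fun b' hb' => ?_).trans Finset.card_le_two
  obtain ⟨hb'p, h⟩ := Finset.mem_filter.1 hb'
  simpa using eq_or_eq_of_meetPt_eq ha (mem_partners.1 hb).1 (mem_partners.1 hb'p).1
    (mem_partners.1 hb'p).2.1 h

lemma le_card_partners (n a : ℕ) (ha : a < n) : n ≤ (partners n a).card + 4 := by
  have hsub : Finset.range n ⊆
      partners n a ∪ {a, third n a a, (n - a) / 2, (2 * n - a) / 2} := by
    intro b hb
    have hb := Finset.mem_range.1 hb
    simp only [Finset.mem_union, mem_partners, Finset.mem_insert, Finset.mem_singleton, third]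
    split_ifs <;> omega
  have := (Finset.card_le_card hsub).trans (Finset.card_union_le _ _)
  have h4 := Finset.card_le_four (a := a) (b := third n a a) (c := (n - a) / 2)
    (d := (2 * n - a) / 2)
  rw [Finset.card_range] at this
  omega

/-! ### Divisibility by the configuration lines -/

section Divisibility

variable {n e : ℕ} {F : MvPolynomial (Fin 3) ℂ}

lemma lineForm_dvd_of_card (hF : F.IsHomogeneous e)
    (hvan : ∀ p ∈ TriplePts n, VanishesToOrder F 3 p) {a : ℕ} (ha : a < n) (U : Finset ℂ)
    (hTU : Disjoint (triplesOn n a) U)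
    (hUa : ∀ z ∈ U, eval (projPt z) (lineForm (Ppt n a)) = 0)
    (hU : ∀ z ∈ U, eval (projPt z) F = 0)
    (hcard : 2 * e < 3 * (partners n a).card + 2 * U.card) : lineForm (Ppt n a) ∣ F := by
  refine lineForm_dvd_of_many_zeros (Ppt_ne_zero n a) hF (triplesOn n a) U hTU ?_ ?_ hU ?_
  · intro z hz
    rcases Finset.mem_union.1 hz with hz | hz
    · obtain ⟨b, hb, rfl⟩ := Finset.mem_image.1 hz
      rw [eval_meetPt ha (mem_partners.1 hb).1]
      simp
    · exact hUa z hz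
  · intro z hz
    obtain ⟨b, hb, rfl⟩ := Finset.mem_image.1 hz
    exact hvan _ (meetPt_mem_TriplePts ha hb)
  · have := card_partners_le ha
    omega

/-- A triple-point count suffices for every line, except for `n = 12` on the lines `2, 6, 10`. -/
lemma lineForm_dvd_of_card_partners (hF : F.IsHomogeneous e) (hen : e ≤ n)
    (hvan : ∀ p ∈ TriplePts n, VanishesToOrder F 3 p) {a : ℕ} (ha : a < n)
    (hcard : 2 * n < 3 * (partners n a).card) : lineForm (Ppt n a) ∣ F :=
  lineForm_dvd_of_card hF hvan ha ∅ (by simp) (by simp) (by simp) (by simp; omega)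

/-- The simple point where the line `a` meets the odd line `6 - a / 2` is a further zero. -/
lemma lineForm_dvd_of_twelve (hF : F.IsHomogeneous e) (hen : e ≤ 12)
    (hvan : ∀ p ∈ TriplePts 12, VanishesToOrder F 3 p) {a : ℕ} (ha : a < 12) :
    lineForm (Ppt 12 a) ∣ F := by
  by_cases hcard : 2 * 12 < 3 * (partners 12 a).card
  · exact lineForm_dvd_of_card_partners hF hen hvan ha hcard
  have key : 24 ≤ 3 * (partners 12 a).card ∧ 2 * 12 < 3 * (partners 12 (6 - a / 2)).card ∧
      third 12 a (6 - a / 2) = 6 - a / 2 ∧ 6 - a / 2 < 12 ∧ 6 - a / 2 ≠ a := by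
    revert hcard
    interval_cases a <;> decide
  obtain ⟨h24, hbcard, hthird, hb, hba⟩ := key
  set b := 6 - a / 2
  obtain ⟨G, hG⟩ := lineForm_dvd_of_card_partners hF hen hvan hb hbcard
  refine lineForm_dvd_of_card hF hvan ha {meetPt 12 a b} ?_ ?_ ?_ (by simp; omega)
  · rw [Finset.disjoint_singleton_right]
    intro hz
    obtain ⟨b', hb', h⟩ := Finset.mem_image.1 hz
    obtain ⟨hb'n, hb'a, -, hb'b⟩ := mem_partners.1 hb'
    have := eq_or_eq_of_meetPt_eq ha hb hb'n hb'a h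
    rw [hthird, or_self] at this
    rw [this] at hb'b
    exact hb'b hthird
  · simp [eval_meetPt ha hb]
  · simp [hG, eval_meetPt ha hb]

lemma lineForm_dvd (hn : 12 ≤ n) (hF : F.IsHomogeneous e) (hen : e ≤ n)
    (hvan : ∀ p ∈ TriplePts n, VanishesToOrder F 3 p) {a : ℕ} (ha : a < n) :
    lineForm (Ppt n a) ∣ F := by
  rcases hn.eq_or_lt with rfl | hn
  · exact lineForm_dvd_of_twelve hF hen hvan ha
  · have := le_card_partners n a ha
    exact lineForm_dvd_of_card_partners hF hen hvan ha (by omega)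

end Divisibility

lemma prod_ell_dvd {n : ℕ} {F : MvPolynomial (Fin 3) ℂ}
    (h : ∀ a < n, lineForm (Ppt n a) ∣ F) : ∏ j ∈ Finset.range n, ell n j ∣ F := by
  refine Finset.prod_dvd_of_isRelPrime (fun i hi j hj hij => ?_) fun j hj =>
    (associated_ell n j).dvd_iff_dvd_left.1 (h j (Finset.mem_range.1 hj))
  have hi := Finset.mem_range.1 hi
  have hj := Finset.mem_range.1 hj
  refine ((associated_ell n i).irreducible (lineForm_prime (Ppt_ne_zero n i)).irreducible
    |>.isRelPrime_iff_not_dvd).2 fun hd => ?_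
  exact not_lineForm_dvd_lineForm (Ppt_ne_zero n j) (fun h => hij (Ppt_injOn hi hj h))
    (((associated_ell n i).dvd.trans hd).trans (associated_ell n j).symm.dvd)

lemma ell_ne_zero (n j : ℕ) : ell n j ≠ 0 :=
  (associated_ell n j).ne_zero_iff.1 (lineForm_ne_zero (Ppt_ne_zero n j))

lemma ell_isHomogeneous (n j : ℕ) : (ell n j).IsHomogeneous 1 := by
  obtain ⟨κ, -, h⟩ := exists_ell_eq n j
  rw [h]
  exact (lineForm_isHomogeneous _).C_mul κ

/-- For `6 ∣ n`, `n ≥ 12`: a nonzero homogeneous form of degree at most `n`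
vanishing to order at least 3 at every triple point has degree exactly `n` and
is a scalar multiple of the product of the `n` defining linear forms of the
configuration lines. -/
theorem boroczky_unique_min_form (n : ℕ) (hn : 12 ≤ n) (hdvd : 6 ∣ n)
    (F : MvPolynomial (Fin 3) ℂ) (hF0 : F ≠ 0) (e : ℕ) (hFe : F.IsHomogeneous e)
    (hen : e ≤ n) (hvan : ∀ p ∈ TriplePts n, VanishesToOrder F 3 p) :
    e = n ∧ ∃ c : ℂ, F = c • ∏ j ∈ Finset.range n, ell n j := by
  obtain ⟨G, hG⟩ := prod_ell_dvd fun a ha => lineForm_dvd hn hFe hen hvan ha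
  have hprod : (∏ j ∈ Finset.range n, ell n j).IsHomogeneous n := by
    simpa using IsHomogeneous.prod (Finset.range n) (ell n) (fun _ => 1)
      fun j _ => ell_isHomogeneous n j
  have hprod0 : ∏ j ∈ Finset.range n, ell n j ≠ 0 :=
    Finset.prod_ne_zero_iff.2 fun j _ => ell_ne_zero n j
  have hG0 : G ≠ 0 := by
    rintro rfl
    exact hF0 (by simpa using hG)
  have hdeg : e = n + G.totalDegree := by
    rw [← hFe.totalDegree hF0, hG, totalDegree_mul_of_isDomain hprod0 hG0,
      hprod.totalDegree hprod0]
  have hC := totalDegree_eq_zero_iff_eq_C.1 (show G.totalDegree = 0 by omega)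
  refine ⟨by omega, G.coeff 0, ?_⟩
  rw [hG, smul_eq_C_mul, ← hC, mul_comm]
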